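/- For every f ∈ I \ {0}, the signature s(f) lies in the normal set NS(Syz(F)) of the syzygies of F. -/

import Mathlib

open MvPolynomial

noncomputable section

namespace TropF5

/-- Variable index type: `none` is the homogenizing variable `h`,
`some (.inl i)` is `x i`, `some (.inr i)` is `∂ i` (resp. `ξ i`). -/
abbrev Vars (n : ℕ) := Option (Fin n ⊕ Fin n)

/-- The commutative polynomial ring `K[h, x, ξ]`. -/
abbrev Poly (n : ℕ) (K : Type*) [Field K] := MvPolynomial (Vars n) K

/-- Monomials (exponent vectors) of `K[h,x,ξ]`. -/
abbrev Mon (n : ℕ) := Vars n →₀ ℕ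

/-- Module monomials `h^γ x^α ξ^β e_i` of `K[h,x,ξ]^N`. -/
abbrev MMon (n N : ℕ) := Mon n × Fin N

/-- Total degree of a monomial. -/
def mdeg {n : ℕ} (d : Mon n) : ℕ := d.sum fun _ k => k

/-- The weight `w·(α,β)` of the `(x,ξ)`-part of a monomial. -/
def wdeg {n : ℕ} (w : Fin n ⊕ Fin n → ℝ) (d : Mon n) : ℝ :=
  ∑ j : Fin n ⊕ Fin n, w j * (d (some j) : ℝ)

/-- The `(x,ξ)`-part `x^α ξ^β` of a monomial `h^γ x^α ξ^β`. -/
def xiPart {n : ℕ} (d : Mon n) : (Fin n ⊕ Fin n) →₀ ℕ :=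
  Finsupp.equivFunOnFinite.symm fun j => d (some j)

/-- The data defining a tropical term order on `K[h,x,ξ]`: a valuation on `K`,
weight vectors `w, ω ∈ ℝ^{2n}`, and a monomial order `prec` used as tie-breaker. -/
structure OrdData (n : ℕ) (K : Type*) [Field K] where
  val : K → ℝ
  val_mul : ∀ a b : K, a ≠ 0 → b ≠ 0 → val (a * b) = val a + val b
  val_add : ∀ a b : K, a ≠ 0 → b ≠ 0 → a + b ≠ 0 → min (val a) (val b) ≤ val (a + b)
  w : Fin n ⊕ Fin n → ℝ
  om : Fin n ⊕ Fin n → ℝ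
  w_nonneg : ∀ i : Fin n, 0 ≤ w (Sum.inl i)
  w_big : ∀ i j : Fin n, w (Sum.inl j) < w (Sum.inr i)
  prec : LinearOrder ((Fin n ⊕ Fin n) →₀ ℕ)
  prec_add : ∀ u v t : (Fin n ⊕ Fin n) →₀ ℕ, prec.lt u v → prec.lt (u + t) (v + t)
  prec_zero_le : ∀ u, prec.le 0 u

variable {n N : ℕ} {K : Type*} [Field K]

/-- The strict tropical term order `<_h` on terms `a·d`, `b·e` of `K[h,x,ξ]`:
first by total degree, then by `w`-weight, then by valuation-adjusted `ω`-weight,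
and finally by the tie-breaking monomial order on the `(x,ξ)`-parts. -/
def ltTerm (D : OrdData n K) (a : K) (d : Mon n) (b : K) (e : Mon n) : Prop :=
  mdeg d < mdeg e ∨ (mdeg d = mdeg e ∧
    (wdeg D.w d < wdeg D.w e ∨ (wdeg D.w d = wdeg D.w e ∧
      (-D.val a + wdeg D.om d < -D.val b + wdeg D.om e ∨
        (-D.val a + wdeg D.om d = -D.val b + wdeg D.om e ∧
          D.prec.lt (xiPart d) (xiPart e))))))

/-- `d` is the `≤_h`-leading monomial of the polynomial `p`. -/
def IsLM (D : OrdData n K) (p : Poly n K) (d : Mon n) : Prop :=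
  d ∈ p.support ∧ ∀ e ∈ p.support, e ≠ d → ltTerm D (p.coeff e) e (p.coeff d) d

open Classical in
/-- The `≤_h`-leading monomial of a polynomial (junk value `0` if there is none). -/
def LM (D : OrdData n K) (p : Poly n K) : Mon n :=
  if h : ∃ d, IsLM D p d then h.choose else 0

/-- The module element `σ e_i` of `K[h,x,ξ]^N` corresponding to a module monomial. -/
def msingle {N : ℕ} (m : MMon n N) : Fin N → Poly n K := Pi.single m.2 (monomial m.1 1)

/-- Product of a monomial with a module monomial. -/
def mulM {N : ℕ} (d : Mon n) (m : MMon n N) : MMon n N := (d + m.1, m.2)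

/-- An abstract setting for the homogenized Weyl algebra `R = D_n^{(h)}(K)`:
a `K`-algebra `R` with generators `h, x_i, ∂_i` satisfying the Weyl relations,
the total-symbol `K`-linear isomorphism `Ψ_h : R ≃ K[h,x,ξ]` sending normally
ordered monomials to monomials, a tropical order datum, and a generating family
`F` of homogeneous elements. -/
structure Setting (n N : ℕ) (K : Type*) [Field K] (R : Type*) [Ring R] [Algebra K R] where
  D : OrdData n K
  /-- the generators: `Xg none = h`, `Xg (some (.inl i)) = x i`, `Xg (some (.inr i)) = ∂ i` -/
  Xg : Vars n → R
  h_comm : ∀ v, Xg none * Xg v = Xg v * Xg none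
  x_comm : ∀ i j : Fin n,
    Xg (some (Sum.inl i)) * Xg (some (Sum.inl j)) = Xg (some (Sum.inl j)) * Xg (some (Sum.inl i))
  d_comm : ∀ i j : Fin n,
    Xg (some (Sum.inr i)) * Xg (some (Sum.inr j)) = Xg (some (Sum.inr j)) * Xg (some (Sum.inr i))
  dx_comm : ∀ i j : Fin n, i ≠ j →
    Xg (some (Sum.inr i)) * Xg (some (Sum.inl j)) = Xg (some (Sum.inl j)) * Xg (some (Sum.inr i))
  dx_h : ∀ i : Fin n,
    Xg (some (Sum.inr i)) * Xg (some (Sum.inl i))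
      = Xg (some (Sum.inl i)) * Xg (some (Sum.inr i)) + Xg none ^ 2
  /-- the total symbol map `Ψ_h` -/
  Psi : R ≃ₗ[K] Poly n K
  Psi_monomial : ∀ d : Mon n,
    Psi (Xg none ^ d none *
      ((List.ofFn fun i : Fin n => Xg (some (Sum.inl i)) ^ d (some (Sum.inl i))).prod *
       (List.ofFn fun i : Fin n => Xg (some (Sum.inr i)) ^ d (some (Sum.inr i))).prod)) =
    monomial d 1
  /-- the generating set `F = {f_1, …, f_N}` -/
  F : Fin N → R
  F_hom : ∀ i, ∃ dF : ℕ, (Psi (F i)).IsHomogeneous dF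

namespace Setting

variable {R : Type*} [Ring R] [Algebra K R] [NeZero N] (S : Setting n N K R)

/-- `ν : R^N → I`, `ν(a) = Σ a_i f_i`. -/
def nu (g : Fin N → R) : R := ∑ i, g i * S.F i

/-- The left ideal `I` generated by `F`. -/
def idl : Submodule R R := Submodule.span R (Set.range S.F)

/-- The componentwise total symbol map `Φ : R^N → K[h,x,ξ]^N`. -/
def Phi (g : Fin N → R) : Fin N → Poly n K := fun i => S.Psi (g i)

/-- The inverse total symbol of a monomial: the monomial `h^γ x^α ∂^β` of `R`. -/
def monR (d : Mon n) : R := S.Psi.symm (monomial d 1)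

/-- `t` is a term (nonzero coefficient times a monomial) of `R`. -/
def IsTermR (t : R) : Prop := ∃ (d : Mon n) (c : K), c ≠ 0 ∧ S.Psi t = monomial d c

/-- `≤_h`-leading monomial of an element of `R` (via its total symbol). -/
def LMr (f : R) : Mon n := LM S.D (S.Psi f)

/-- `≤_h`-leading coefficient of an element of `R`. -/
def LCr (f : R) : K := (S.Psi f).coeff (S.LMr f)

/-- `LT_h f ≤_h LT_h g` (strictly smaller, or equal monomials and equal valuations). -/
def leLT (f g : R) : Prop :=
  ltTerm S.D (S.LCr f) (S.LMr f) (S.LCr g) (S.LMr g) ∨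
    (S.D.val (S.LCr f) = S.D.val (S.LCr g) ∧ S.LMr f = S.LMr g)


/-- `m` is the leading monomial of the syzygy `a`: writing `m = (d, i)`,
`i` is the largest index with `a i ≠ 0` and `d = LM_h (a i)`. -/
def IsSyzLM (m : MMon n N) : Prop :=
  ∃ a : Fin N → R, S.nu a = 0 ∧ a m.2 ≠ 0 ∧ (∀ j, m.2 < j → a j = 0) ∧
    IsLM S.D (S.Psi (a m.2)) m.1

/-- `LSyz(F)`: the `K[h,x,ξ]`-submodule generated by leading monomials of syzygies. -/
def LSyz : Submodule (Poly n K) (Fin N → Poly n K) :=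
  Submodule.span _ { v | ∃ m : MMon n N, S.IsSyzLM m ∧ v = msingle m }

/-- Membership of a module monomial in `LSyz(F)`. -/
def inLSyz (m : MMon n N) : Prop := msingle m ∈ S.LSyz

/-- The strict total order `<_sign` on module monomials. -/
def ltSign (m m' : MMon n N) : Prop :=
  m.2 < m'.2 ∨ (m.2 = m'.2 ∧ (mdeg m.1 < mdeg m'.1 ∨ (mdeg m.1 = mdeg m'.1 ∧
    (wdeg S.D.w m.1 < wdeg S.D.w m'.1 ∨ (wdeg S.D.w m.1 = wdeg S.D.w m'.1 ∧
      ((¬ S.inLSyz m ∧ S.inLSyz m') ∨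
        ((S.inLSyz m ↔ S.inLSyz m') ∧ S.D.prec.lt (xiPart m.1) (xiPart m'.1))))))))

/-- `m` is the `≤_sign`-largest module monomial of `Φ(g)`. -/
def IsLMsign (g : Fin N → R) (m : MMon n N) : Prop :=
  m.1 ∈ (S.Psi (g m.2)).support ∧
    ∀ m' : MMon n N, m'.1 ∈ (S.Psi (g m'.2)).support → m' ≠ m → S.ltSign m' m

open Classical in
/-- `LM_sign(g)` (junk value if there is none). -/
def LMsign (g : Fin N → R) : MMon n N :=
  if h : ∃ m, S.IsLMsign g m then h.choose else ((0 : Mon n), (0 : Fin N))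

/-- `m` is the signature of `f`: the `≤_sign`-minimum of
`{LM_sign(g) : ν(g) = f}`. -/
def IsSig (f : R) (m : MMon n N) : Prop :=
  (∃ g : Fin N → R, S.nu g = f ∧ S.IsLMsign g m) ∧
    ∀ (g : Fin N → R) (m' : MMon n N), S.nu g = f → S.IsLMsign g m' → ¬ S.ltSign m' m

open Classical in
/-- The signature `s(f)` of `f ∈ I \ {0}` (junk value if there is none). -/
def sig (f : R) : MMon n N :=
  if h : ∃ m, S.IsSig f m then h.choose else ((0 : Mon n), (0 : Fin N))


/-- A module element is clean if `ν(g) ≠ 0` and no module monomial of `Φ(g)`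
belongs to `LSyz(F)`. -/
def Clean (g : Fin N → R) : Prop :=
  S.nu g ≠ 0 ∧ ∀ m : MMon n N, m.1 ∈ (S.Psi (g m.2)).support → ¬ S.inLSyz m

/-- `f` is `s`-top-reducible with respect to the module monomial `m`:
some `g ∈ I \ {0}` and term `t` satisfy `LM_h(t g) = LM_h(f)` and `s(t g) <_sign m`. -/
def sTopRed (f : R) (m : MMon n N) : Prop :=
  ∃ g ∈ S.idl, g ≠ 0 ∧ ∃ t : R, S.IsTermR t ∧
    S.LMr (t * g) = S.LMr f ∧ S.ltSign (S.sig (t * g)) m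

/-- `f` is `s`-top-irreducible with respect to `m`. -/
def sTopIrr (f : R) (m : MMon n N) : Prop := f = 0 ∨ ¬ S.sTopRed f m

/-- `σ` is the value `Ω(m)`: the `≤_sign`-minimum of
`{s(f) : f ∈ I \ {0}, LM_h(f) = m}`. -/
def IsOmega (m : Mon n) (σ : MMon n N) : Prop :=
  (∃ f, f ∈ S.idl ∧ f ≠ 0 ∧ S.LMr f = m ∧ S.sig f = σ) ∧
    ∀ f, f ∈ S.idl → f ≠ 0 → S.LMr f = m → ¬ S.ltSign (S.sig f) σ

open Classical in
/-- The map `Ω` (junk value if the minimum does not exist). -/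
def Omega (m : Mon n) : MMon n N :=
  if h : ∃ σ, S.IsOmega m σ then h.choose else ((0 : Mon n), (0 : Fin N))

/-- `G` is an `s`-Gröbner basis of `I`. -/
def IsSGB (G : Set R) : Prop :=
  G.Nonempty ∧ Submodule.span R G = S.idl ∧
    ∀ f ∈ S.idl, f ≠ 0 → S.sTopIrr f (S.sig f) →
      ∃ g ∈ G, ∃ d : Mon n,
        S.LMr (S.monR d * g) = S.LMr f ∧ mulM d (S.sig g) = S.sig f

/-- `G` is a (tropical) Gröbner basis of `I`:
`RG = I` and `⟨LM_h(G)⟩ = ⟨LM_h(I)⟩`. -/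
def IsGB (G : Set R) : Prop :=
  G.Nonempty ∧ Submodule.span R G = S.idl ∧
    Ideal.span ((fun g => (monomial (S.LMr g) 1 : Poly n K)) '' {g | g ∈ G ∧ g ≠ 0}) =
      Ideal.span ((fun g => (monomial (S.LMr g) 1 : Poly n K)) '' {f | f ∈ S.idl ∧ f ≠ 0})

/-- `g` is primitive `s`-top-irreducible. -/
def Primitive (g : R) : Prop :=
  g ∈ S.idl ∧ g ≠ 0 ∧ S.sTopIrr g (S.sig g) ∧
    ¬ ∃ g', g' ∈ S.idl ∧ g' ≠ 0 ∧ S.sTopIrr g' (S.sig g') ∧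
      ∃ d : Mon n, d ≠ 0 ∧ S.LMr (S.monR d * g') = S.LMr g ∧
        S.sig (S.monR d * g') = S.sig g

/-- `f` is redundant to `G`. -/
def Redundant (f : R) (G : Set R) : Prop :=
  f ≠ 0 ∧ ∃ g ∈ G, ∃ (d : Mon n) (c : K), c ≠ 0 ∧
    f = S.Psi.symm (monomial d c) * g ∧ S.ltSign (S.sig f) (mulM d (S.sig g))

/-- The cofactor `u_1` of the S-pair of `(g_1, g_2)`. -/
def u1 (g1 g2 : R) : R :=
  S.Psi.symm (monomial ((S.LMr g1 ⊔ S.LMr g2) - S.LMr g1) (S.LCr g2))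

/-- The cofactor `u_2` of the S-pair of `(g_1, g_2)`. -/
def u2 (g1 g2 : R) : R :=
  S.Psi.symm (monomial ((S.LMr g1 ⊔ S.LMr g2) - S.LMr g2) (S.LCr g1))

/-- The S-pair `spair(g_1, g_2) = u_1 g_1 - u_2 g_2`. -/
def spair (g1 g2 : R) : R := S.u1 g1 g2 * g1 - S.u2 g1 g2 * g2

/-- `(g_1, g_2)` is a normal pair relative to `G`. -/
def NormalPair (G : Set R) (g1 g2 : R) : Prop :=
  S.Primitive g1 ∧ S.Primitive g2 ∧
    S.sig (S.u1 g1 g2 * g1) = mulM ((S.LMr g1 ⊔ S.LMr g2) - S.LMr g1) (S.sig g1) ∧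
    S.sig (S.u2 g1 g2 * g2) = mulM ((S.LMr g1 ⊔ S.LMr g2) - S.LMr g2) (S.sig g2) ∧
    S.sig (S.u1 g1 g2 * g1) ≠ S.sig (S.u2 g1 g2 * g2) ∧
    ¬ S.Redundant (S.spair g1 g2) G

end Setting

end TropF5

section Generic

theorem Finset.exists_forall_rel_of_trichotomous {α : Type*} {r : α → α → Prop}
    (htrans : ∀ a b c, r a b → r b c → r a c) (htri : ∀ a b, a ≠ b → r a b ∨ r b a)
    (s : Finset α) (hs : s.Nonempty) : ∃ m ∈ s, ∀ x ∈ s, x ≠ m → r x m := by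
  classical
  induction hs using Finset.Nonempty.cons_induction with
  | singleton a => exact ⟨a, by simp, by simp⟩
  | cons a s ha hs ih =>
    obtain ⟨m, hm, hmax⟩ := ih
    have hma : m ≠ a := fun h => ha (h ▸ hm)
    rcases htri m a hma with h | h
    · refine ⟨a, by simp, fun x hx hxa => ?_⟩
      rcases Finset.mem_cons.1 hx with rfl | hx
      · exact absurd rfl hxa
      · by_cases hxm : x = m
        · exact hxm ▸ h
        · exact htrans _ _ _ (hmax x hx hxm) h
    · refine ⟨m, by simp [hm], fun x hx hxm => ?_⟩
      rcases Finset.mem_cons.1 hx with rfl | hx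
      · exact h
      · exact hmax x hx hxm

variable {R : Type*} [Ring R] {n : ℕ}

theorem commute_prod_ofFn_pow {y : Fin n → R} {z : R} (h : ∀ j, Commute z (y j)) (a : Fin n → ℕ) :
    Commute z (List.ofFn fun j => y j ^ a j).prod := by
  refine Commute.list_prod_right _ _ fun b hb => ?_
  obtain ⟨j, rfl⟩ := (List.mem_ofFn' _ _).1 hb
  exact (h j).pow_right _

theorem mul_prod_ofFn_pow {y : Fin n → R} (h : ∀ i j, Commute (y i) (y j)) (i : Fin n)
    (a : Fin n → ℕ) :
    y i * (List.ofFn fun j => y j ^ a j).prod =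
      (List.ofFn fun j => y j ^ (a j + (Pi.single i 1 : Fin n → ℕ) j)).prod := by
  induction n with
  | zero => exact i.elim0
  | succ n ih =>
    simp only [List.ofFn_succ, List.prod_cons]
    cases i using Fin.cases with
    | zero => simp [← mul_assoc, pow_succ']
    | succ i =>
      rw [← mul_assoc, ((h i.succ 0).pow_right _).eq, mul_assoc,
        ih (y := fun j => y j.succ) (fun i j => h i.succ j.succ) i fun j => a j.succ]
      simp [Pi.single_apply, Fin.ext_iff]

theorem mul_pow_of_mul_eq_add {D y c : R} (h : D * y = y * D + c) (hc : Commute c y) (k : ℕ) :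
    D * y ^ k = y ^ k * D + k • (c * y ^ (k - 1)) := by
  induction k with
  | zero => simp
  | succ k ih =>
    have e : k • (c * y ^ (k - 1)) * y = k • (c * y ^ k) := by
      cases k with
      | zero => simp
      | succ k => simp [pow_succ, mul_assoc]
    rw [pow_succ, ← mul_assoc, ih, add_mul, e, mul_assoc, h, mul_add, ← mul_assoc,
      (hc.symm.pow_left k).eq, add_assoc, succ_nsmul', Nat.add_sub_cancel]

theorem mul_prod_ofFn_pow_of_mul_eq_add {y : Fin n → R} {D c : R} {i : Fin n}
    (h : D * y i = y i * D + c) (hD : ∀ j, i ≠ j → Commute D (y j)) (hc : ∀ j, Commute c (y j))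
    (a : Fin n → ℕ) :
    D * (List.ofFn fun j => y j ^ a j).prod = (List.ofFn fun j => y j ^ a j).prod * D +
      a i • (c * (List.ofFn fun j => y j ^ (a j - (Pi.single i 1 : Fin n → ℕ) j)).prod) := by
  induction n with
  | zero => exact i.elim0
  | succ n ih =>
    simp only [List.ofFn_succ, List.prod_cons]
    cases i using Fin.cases with
    | zero =>
      have hT := commute_prod_ofFn_pow (y := fun j : Fin n => y j.succ)
        (fun j => hD j.succ (Fin.succ_ne_zero j).symm) fun j => a j.succ
      rw [← mul_assoc, mul_pow_of_mul_eq_add h (hc 0), add_mul, mul_assoc, hT.eq]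
      simp [mul_assoc]
    | succ i =>
      have key := ih (y := fun j => y j.succ) (i := i) h
        (fun j hj => hD j.succ (by simpa using hj)) (fun j => hc j.succ) fun j => a j.succ
      rw [← mul_assoc, ((hD 0 (Fin.succ_ne_zero i)).pow_right _).eq, mul_assoc, key, mul_add,
        ← mul_assoc, mul_smul_comm, ← mul_assoc, ← ((hc 0).pow_right _).eq, mul_assoc c]
      simp [Pi.single_apply, Fin.ext_iff, (Fin.succ_ne_zero i).symm]

end Generic

namespace TropF5

section Monomials

variable {n : ℕ} {K : Type*} [Field K]

theorem mdeg_eq_sum (d : Mon n) : mdeg d = ∑ v, d v :=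
  Finsupp.sum_fintype _ _ fun _ => rfl

theorem mdeg_add (d e : Mon n) : mdeg (d + e) = mdeg d + mdeg e := by
  simp [mdeg_eq_sum, Finset.sum_add_distrib]

theorem mdeg_single (v : Vars n) (k : ℕ) : mdeg (Finsupp.single v k) = k := by
  simp [mdeg]

theorem wdeg_add (w : Fin n ⊕ Fin n → ℝ) (d e : Mon n) :
    wdeg w (d + e) = wdeg w d + wdeg w e := by
  simp [wdeg, mul_add, Finset.sum_add_distrib]

theorem wdeg_single_none (w : Fin n ⊕ Fin n → ℝ) (k : ℕ) :
    wdeg w (Finsupp.single none k) = 0 := by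
  simp [wdeg]

theorem wdeg_single_some (w : Fin n ⊕ Fin n → ℝ) (j : Fin n ⊕ Fin n) (k : ℕ) :
    wdeg w (Finsupp.single (some j) k) = w j * k := by
  classical
  simp [wdeg, Finsupp.single_apply, -Fintype.sum_sum_type]

theorem xiPart_add (d e : Mon n) : xiPart (d + e) = xiPart d + xiPart e := by
  ext j
  simp [xiPart]

theorem eq_of_mdeg_eq_of_xiPart_eq {d e : Mon n} (h : mdeg d = mdeg e)
    (hx : xiPart d = xiPart e) : d = e := by
  have hs (j) : d (some j) = e (some j) := by simpa [xiPart] using DFunLike.congr_fun hx j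
  have hn : d none = e none := by
    simpa [mdeg_eq_sum, Fintype.sum_option, hs] using h
  ext (_ | j)
  · exact hn
  · exact hs j

theorem finite_setOf_mdeg_eq (k : ℕ) : {d : Mon n | mdeg d = k}.Finite := by
  refine (Set.finite_Iic (Finsupp.equivFunOnFinite.symm fun _ => k : Mon n)).subset ?_
  rintro d rfl v
  simpa [mdeg_eq_sum] using Finset.single_le_sum (fun i _ => Nat.zero_le (d i)) (Finset.mem_univ v)

end Monomials

namespace Setting

variable {n N : ℕ} {K R : Type*} [Field K] [Ring R] [Algebra K R] (S : Setting n N K R)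

theorem psi_monR (d : Mon n) : S.Psi (S.monR d) = monomial d 1 :=
  S.Psi.apply_symm_apply _

theorem monR_eq (d : Mon n) : S.monR d = S.Xg none ^ d none *
    ((List.ofFn fun i => S.Xg (some (Sum.inl i)) ^ d (some (Sum.inl i))).prod *
      (List.ofFn fun i => S.Xg (some (Sum.inr i)) ^ d (some (Sum.inr i))).prod) := by
  rw [monR, ← S.Psi_monomial, LinearEquiv.symm_apply_apply]

theorem sum_coeff_smul_monR (a : R) :
    ∑ t ∈ (S.Psi a).support, (S.Psi a).coeff t • S.monR t = a := by
  apply S.Psi.injective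
  conv_rhs => rw [(S.Psi a).as_sum]
  simp [psi_monR, smul_monomial]

theorem commute_h (v : Vars n) : Commute (S.Xg none) (S.Xg v) := S.h_comm v

theorem h_mul_monR (d : Mon n) :
    S.Xg none * S.monR d = S.monR (Finsupp.single none 1 + d) := by
  rw [monR_eq, monR_eq, ← mul_assoc, ← pow_succ']
  simp [add_comm]

theorem x_mul_monR (i : Fin n) (d : Mon n) :
    S.Xg (some (Sum.inl i)) * S.monR d =
      S.monR (Finsupp.single (some (Sum.inl i)) 1 + d) := by
  classical
  rw [monR_eq, monR_eq, ← mul_assoc, ← ((S.commute_h _).pow_left _).eq, mul_assoc,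
    ← mul_assoc (S.Xg (some (Sum.inl i))),
    mul_prod_ofFn_pow (y := fun j => S.Xg (some (Sum.inl j))) S.x_comm]
  simp [Finsupp.single_apply, Pi.single_apply, add_comm, eq_comm]

theorem d_mul_monR (i : Fin n) (d : Mon n) :
    S.Xg (some (Sum.inr i)) * S.monR d =
      S.monR (Finsupp.single (some (Sum.inr i)) 1 + d) + d (some (Sum.inl i)) •
        S.monR (Finsupp.single none 2 + (d - Finsupp.single (some (Sum.inl i)) 1)) := by
  classical
  rw [monR_eq, monR_eq, monR_eq, ← mul_assoc, ← ((S.commute_h _).pow_left _).eq, mul_assoc,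
    ← mul_assoc (S.Xg (some (Sum.inr i))),
    mul_prod_ofFn_pow_of_mul_eq_add (y := fun j => S.Xg (some (Sum.inl j))) (S.dx_h i)
      (S.dx_comm i) (fun j => (S.commute_h _).pow_left 2), add_mul, mul_add, mul_assoc,
    mul_prod_ofFn_pow (y := fun j => S.Xg (some (Sum.inr j))) S.d_comm]
  congr 1
  · simp [Finsupp.single_apply, Pi.single_apply, add_comm, eq_comm]
  · rw [smul_mul_assoc, mul_smul_comm, mul_assoc, ← mul_assoc (_ ^ _), ← pow_add]
    simp [Finsupp.single_apply, Pi.single_apply, add_comm, eq_comm]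

/-- The span of the monomials of the same degree as `d` and smaller `w`-weight. -/
def lower (d : Mon n) : Submodule K R :=
  Submodule.span K (S.monR '' {t | mdeg t = mdeg d ∧ wdeg S.D.w t < wdeg S.D.w d})

theorem monR_mem_lower {t d : Mon n} (h : mdeg t = mdeg d) (hw : wdeg S.D.w t < wdeg S.D.w d) :
    S.monR t ∈ S.lower d :=
  Submodule.subset_span ⟨t, ⟨h, hw⟩, rfl⟩

theorem lower_mono {t d : Mon n} (h : mdeg t = mdeg d) (hw : wdeg S.D.w t < wdeg S.D.w d) :
    S.lower t ≤ S.lower d :=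
  Submodule.span_mono <| Set.image_mono fun _ hs => ⟨hs.1.trans h, hs.2.trans hw⟩

theorem of_coeff_ne_zero_of_mem_lower {d s : Mon n} {r : R} (hr : r ∈ S.lower d)
    (hs : (S.Psi r).coeff s ≠ 0) : mdeg s = mdeg d ∧ wdeg S.D.w s < wdeg S.D.w d := by
  classical
  by_contra hd
  apply hs
  have hle : S.lower d ≤ LinearMap.ker (lcoeff K s ∘ₗ S.Psi.toLinearMap) := by
    refine Submodule.span_le.2 ?_
    rintro _ ⟨t, ht, rfl⟩
    have hts : t ≠ s := fun h => hd (h ▸ ht)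
    simp [psi_monR, coeff_monomial, hts]
  simpa using hle hr

/-- `u` has the symbol `e` up to terms of smaller `w`-weight. -/
def HasSymbol (u : R) (e : Mon n) : Prop :=
  ∀ d, u * S.monR d - S.monR (e + d) ∈ S.lower (e + d)

variable {S}

theorem HasSymbol.mul_mem_lower {u : R} {e d : Mon n} (hu : S.HasSymbol u e) {r : R}
    (hr : r ∈ S.lower d) : u * r ∈ S.lower (e + d) := by
  have hle : S.lower d ≤ (S.lower (e + d)).comap (LinearMap.mulLeft K u) := by
    refine Submodule.span_le.2 ?_
    rintro _ ⟨t, ⟨ht, hw⟩, rfl⟩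
    have h1 : mdeg (e + t) = mdeg (e + d) := by rw [mdeg_add, mdeg_add, ht]
    have h2 : wdeg S.D.w (e + t) < wdeg S.D.w (e + d) := by
      rw [wdeg_add, wdeg_add]
      linarith
    simpa using add_mem (S.lower_mono h1 h2 (hu t)) (S.monR_mem_lower h1 h2)
  exact hle hr

theorem HasSymbol.mul {u v : R} {e t : Mon n} (hu : S.HasSymbol u e) (hv : S.HasSymbol v t) :
    S.HasSymbol (u * v) (e + t) := by
  intro d
  have h := add_mem (hu.mul_mem_lower (hv d)) (hu (t + d))
  rw [← add_assoc] at h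
  convert h using 1
  rw [mul_sub, mul_assoc]
  abel

theorem hasSymbol_one : S.HasSymbol 1 0 := by
  simp [HasSymbol]

theorem HasSymbol.pow {u : R} {e : Mon n} (hu : S.HasSymbol u e) (k : ℕ) :
    S.HasSymbol (u ^ k) (k • e) := by
  induction k with
  | zero => simpa using hasSymbol_one
  | succ k ih =>
    rw [pow_succ, succ_nsmul]
    exact ih.mul hu

theorem HasSymbol.prod_ofFn {m : ℕ} {u : Fin m → R} {e : Fin m → Mon n}
    (h : ∀ i, S.HasSymbol (u i) (e i)) : S.HasSymbol (List.ofFn u).prod (∑ i, e i) := by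
  induction m with
  | zero => simpa using hasSymbol_one
  | succ m ih =>
    rw [List.ofFn_succ, List.prod_cons, Fin.sum_univ_succ]
    exact (h 0).mul (ih fun i => h i.succ)

variable (S)

theorem hasSymbol_Xg : ∀ v : Vars n, S.HasSymbol (S.Xg v) (Finsupp.single v 1)
  | none => fun d => by simp [h_mul_monR]
  | some (Sum.inl i) => fun d => by simp [x_mul_monR]
  | some (Sum.inr i) => fun d => by
    rw [d_mul_monR, add_sub_cancel_left]
    rcases Nat.eq_zero_or_pos (d (some (Sum.inl i))) with h | h
    · simp [h]
    · have hd : Finsupp.single (some (Sum.inl i)) 1 + (d - Finsupp.single (some (Sum.inl i)) 1)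
          = d := add_tsub_cancel_of_le (Finsupp.single_le_iff.2 h)
      set t := d - Finsupp.single (some (Sum.inl i)) 1
      refine nsmul_mem (S.monR_mem_lower ?_ ?_) _
      · simp only [← hd, mdeg_add, mdeg_single]
        lia
      · simp only [← hd, wdeg_add, wdeg_single_none, wdeg_single_some]
        have h1 := S.D.w_nonneg i
        have h2 := S.D.w_big i i
        norm_num
        linarith

theorem hasSymbol_monR (e : Mon n) : S.HasSymbol (S.monR e) e := by
  have h := ((S.hasSymbol_Xg none).pow (e none)).mul
    ((HasSymbol.prod_ofFn fun i => (S.hasSymbol_Xg (some (Sum.inl i))).pow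
      (e (some (Sum.inl i)))).mul
    (HasSymbol.prod_ofFn fun i => (S.hasSymbol_Xg (some (Sum.inr i))).pow (e (some (Sum.inr i)))))
  rw [← monR_eq] at h
  convert h using 1
  conv_lhs => rw [← Finsupp.univ_sum_single e, Fintype.sum_option, Fintype.sum_sum_type]
  simp [Finsupp.smul_single]

theorem coeff_monR_mul (e : Mon n) (a : R) (s : Mon n) :
    (S.Psi (S.monR e * a)).coeff s =
      ∑ t ∈ (S.Psi a).support, (S.Psi a).coeff t * (S.Psi (S.monR e * S.monR t)).coeff s := by
  conv_lhs => rw [← S.sum_coeff_smul_monR a]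
  simp [Finset.mul_sum, coeff_sum]

theorem coeff_monR_mul_monR_of_not_lower {e t s : Mon n}
    (h : ¬(mdeg s = mdeg (e + t) ∧ wdeg S.D.w s < wdeg S.D.w (e + t))) :
    (S.Psi (S.monR e * S.monR t)).coeff s = (monomial (e + t) (1 : K)).coeff s := by
  have h0 : (S.Psi (S.monR e * S.monR t - S.monR (e + t))).coeff s = 0 := by
    by_contra hne
    exact h (S.of_coeff_ne_zero_of_mem_lower (S.hasSymbol_monR e t) hne)
  rwa [map_sub, psi_monR, coeff_sub, sub_eq_zero] at h0

theorem exists_of_coeff_monR_mul_ne_zero {e s : Mon n} {a : R}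
    (hs : (S.Psi (S.monR e * a)).coeff s ≠ 0) : ∃ t ∈ (S.Psi a).support,
      s = e + t ∨ (mdeg s = mdeg (e + t) ∧ wdeg S.D.w s < wdeg S.D.w (e + t)) := by
  classical
  rw [coeff_monR_mul] at hs
  obtain ⟨t, ht, hne⟩ := Finset.exists_ne_zero_of_sum_ne_zero hs
  refine ⟨t, ht, ?_⟩
  by_contra! hcon
  rw [S.coeff_monR_mul_monR_of_not_lower fun h => (hcon.2 h.1).not_gt h.2, coeff_monomial,
    if_neg hcon.1.symm, mul_zero] at hne
  exact hne rfl

theorem coeff_monR_mul_add {e t : Mon n} {a : R}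
    (h : ∀ t' ∈ (S.Psi a).support, ¬(mdeg t = mdeg t' ∧ wdeg S.D.w t < wdeg S.D.w t')) :
    (S.Psi (S.monR e * a)).coeff (e + t) = (S.Psi a).coeff t := by
  classical
  have hterm : ∀ t' ∈ (S.Psi a).support, (S.Psi a).coeff t' *
      (S.Psi (S.monR e * S.monR t')).coeff (e + t) = if t' = t then (S.Psi a).coeff t' else 0 := by
    intro t' ht'
    rw [S.coeff_monR_mul_monR_of_not_lower (by simpa [mdeg_add, wdeg_add] using h t' ht'),
      coeff_monomial]
    simp
  rw [coeff_monR_mul, Finset.sum_congr rfl hterm]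
  simp +contextual [eq_comm]

end Setting

section Order

variable {n : ℕ} {K : Type*} [Field K] {D : OrdData n K}

theorem ltTerm_add {a b : K} {d t : Mon n} (e : Mon n) (h : ltTerm D a d b t) :
    ltTerm D a (e + d) b (e + t) := by
  have hp := fun hlt => D.prec_add (xiPart d) (xiPart t) (xiPart e) hlt
  simp only [ltTerm, mdeg_add, wdeg_add, xiPart_add, add_comm (xiPart e)] at h ⊢
  rcases h with h | ⟨h1, h | ⟨h2, h | ⟨h3, h⟩⟩⟩
  · exact Or.inl (by lia)
  · exact Or.inr ⟨by lia, Or.inl (by linarith)⟩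
  · exact Or.inr ⟨by lia, Or.inr ⟨by linarith, Or.inl (by linarith)⟩⟩
  · exact Or.inr ⟨by lia, Or.inr ⟨by linarith, Or.inr ⟨by linarith, hp h⟩⟩⟩

theorem IsLM.level_le {p : Poly n K} {d : Mon n} (h : IsLM D p d) {t : Mon n}
    (ht : t ∈ p.support) :
    mdeg t < mdeg d ∨ (mdeg t = mdeg d ∧ wdeg D.w t ≤ wdeg D.w d) := by
  by_cases htd : t = d
  · simp [htd]
  · rcases h.2 t ht htd with h | ⟨h1, h | ⟨h2, -⟩⟩
    · exact Or.inl h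
    · exact Or.inr ⟨h1, h.le⟩
    · exact Or.inr ⟨h1, h2.le⟩

theorem Setting.isLM_monR_mul {N : ℕ} {R : Type*} [Ring R] [Algebra K R] (S : Setting n N K R)
    {a : R} {d : Mon n} (e : Mon n) (h : IsLM S.D (S.Psi a) d) :
    IsLM S.D (S.Psi (S.monR e * a)) (e + d) := by
  have hc : (S.Psi (S.monR e * a)).coeff (e + d) = (S.Psi a).coeff d :=
    S.coeff_monR_mul_add fun t' ht' hlt => by
      rcases h.level_le ht' with h' | h'
      · exact h'.ne' hlt.1
      · exact h'.2.not_gt hlt.2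
  refine ⟨?_, fun s hs hne => ?_⟩
  · rw [mem_support_iff, hc]
    exact mem_support_iff.1 h.1
  · rw [hc]
    obtain ⟨t, ht, rfl | hlow⟩ := S.exists_of_coeff_monR_mul_ne_zero (mem_support_iff.1 hs)
    · have htd : t ≠ d := fun hh => hne (hh ▸ rfl)
      have hlt := h.2 t ht htd
      by_cases hlev : mdeg t = mdeg d ∧ wdeg S.D.w t = wdeg S.D.w d
      · rw [S.coeff_monR_mul_add fun t' ht' hlt' => ?_]
        · exact ltTerm_add e hlt
        · rcases h.level_le ht' with h' | h'
          · lia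
          · linarith [h'.2, hlt'.2, hlev.2]
      · rcases h.level_le ht with h' | h'
        · exact Or.inl (by simpa [mdeg_add] using h')
        · refine Or.inr ⟨by simpa [mdeg_add] using h'.1, Or.inl ?_⟩
          simpa [wdeg_add] using h'.2.lt_of_ne fun hw => hlev ⟨h'.1, hw⟩
    · rcases h.level_le ht with h' | h'
      · exact Or.inl (by simpa [hlow.1, mdeg_add] using h')
      · refine Or.inr ⟨by simpa [hlow.1, mdeg_add] using h'.1, Or.inl (hlow.2.trans_le ?_)⟩
        simpa [wdeg_add] using h'.2

end Order

section Valuation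

variable {n : ℕ} {K : Type*} [Field K] (D : OrdData n K)

theorem OrdData.val_neg {a : K} (ha : a ≠ 0) : D.val (-a) = D.val a := by
  have h1 : D.val 1 = 0 := by simpa using D.val_mul 1 1 one_ne_zero one_ne_zero
  have h2 : D.val (-1) = 0 := by
    have h := D.val_mul (-1) (-1) (by simp) (by simp)
    rw [neg_mul_neg, one_mul, h1] at h
    linarith
  rw [← neg_one_mul, D.val_mul _ _ (by simp) ha, h2, zero_add]

theorem OrdData.lt_val_sum {ι : Type*} {v : ℝ} (s : Finset ι) (f : ι → K)
    (h : ∀ i ∈ s, f i ≠ 0 → v < D.val (f i)) (hs : ∑ i ∈ s, f i ≠ 0) :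
    v < D.val (∑ i ∈ s, f i) := by
  classical
  induction s using Finset.induction with
  | empty => simp at hs
  | insert i s his ih =>
    rw [Finset.sum_insert his] at hs ⊢
    have ih := ih fun j hj => h j (Finset.mem_insert_of_mem hj)
    have hi := h i (Finset.mem_insert_self i s)
    by_cases hf : f i = 0
    · rw [hf, zero_add] at hs ⊢
      exact ih hs
    · by_cases hS : ∑ j ∈ s, f j = 0
      · rw [hS, add_zero]
        exact hi hf
      · exact (lt_min (hi hf) (ih hS)).trans_le (D.val_add _ _ hf hS hs)

/-- Polynomials with distinct leading monomials in a finite set `L` of monomials of the same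
degree and `w`-weight are determined on `L`: every prescription of coefficients on `L` is
realized by a linear combination. -/
theorem exists_coeff_sum_eq {L : Finset (Mon n)} (p : L → Poly n K)
    (hlev : ∀ l l' : L, mdeg l.1 = mdeg l'.1 ∧ wdeg D.w l.1 = wdeg D.w l'.1)
    (hp : ∀ l, IsLM D (p l) l.1) (b : L → K) :
    ∃ c : L → K, ∀ l' : L, ∑ l, c l * (p l).coeff l'.1 = b l' := by
  classical
  let T : (L → K) →ₗ[K] (L → K) :=
    { toFun := fun c l' => ∑ l, c l * (p l).coeff l'.1
      map_add' := fun c c' => by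
        ext l'
        simp [add_mul, Finset.sum_add_distrib]
      map_smul' := fun a c => by
        ext l'
        simp [Finset.mul_sum, mul_assoc] }
  suffices hinj : Function.Injective T by
    obtain ⟨c, hc⟩ := LinearMap.injective_iff_surjective.1 hinj b
    exact ⟨c, fun l' => congrFun hc l'⟩
  refine (injective_iff_map_eq_zero T).2 fun c hc => ?_
  by_contra hne
  let lc : L → K := fun l => (p l).coeff l.1
  have hlc : ∀ l, lc l ≠ 0 := fun l => mem_support_iff.1 (hp l).1
  let key : L → ℝ := fun l => -D.val (c l * lc l) + wdeg D.om l.1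
  let r : L → L → Prop := fun l l' =>
    key l < key l' ∨ (key l = key l' ∧ D.prec.lt (xiPart l.1) (xiPart l'.1))
  have hplt {u v t} : D.prec.lt u v → D.prec.lt v t → D.prec.lt u t :=
    @lt_trans _ D.prec.toPreorder u v t
  obtain ⟨l₀, hl₀, hmax⟩ := Finset.exists_forall_rel_of_trichotomous (r := r)
    (fun a b c hab hbc => by
      rcases hab with h | ⟨h, h'⟩ <;> rcases hbc with k | ⟨k, k'⟩
      · exact Or.inl (h.trans k)
      · exact Or.inl (k ▸ h)
      · exact Or.inl (h ▸ k)
      · exact Or.inr ⟨h.trans k, hplt h' k'⟩)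
    (fun a b hab => by
      rcases lt_trichotomy (key a) (key b) with h | h | h
      · exact Or.inl (Or.inl h)
      · have hx : xiPart a.1 ≠ xiPart b.1 := fun hx =>
          hab (Subtype.ext (eq_of_mdeg_eq_of_xiPart_eq (hlev a b).1 hx))
        rcases @lt_or_gt_of_ne _ D.prec _ _ hx with hx | hx
        · exact Or.inl (Or.inr ⟨h, hx⟩)
        · exact Or.inr (Or.inr ⟨h.symm, hx⟩)
      · exact Or.inr (Or.inl h))
    (Finset.univ.filter fun l => c l ≠ 0) (by
      obtain ⟨l, hl⟩ := Function.ne_iff.1 hne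
      exact ⟨l, by simpa using hl⟩)
  have hc₀ : c l₀ ≠ 0 := (Finset.mem_filter.1 hl₀).2
  have hsum : ∑ l, c l * (p l).coeff l₀.1 = 0 := congrFun hc l₀
  rw [← Finset.add_sum_erase _ _ (Finset.mem_univ l₀), add_eq_zero_iff_eq_neg'] at hsum
  have hlead : c l₀ * (p l₀).coeff l₀.1 ≠ 0 := mul_ne_zero hc₀ (hlc l₀)
  have hlt := D.lt_val_sum (v := D.val (c l₀ * lc l₀)) (Finset.univ.erase l₀)
    (fun l => c l * (p l).coeff l₀.1) (fun l hl hfl => by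
      have hll : l ≠ l₀ := Finset.ne_of_mem_erase hl
      have hcl : c l ≠ 0 := left_ne_zero_of_mul hfl
      have hpl : (p l).coeff l₀.1 ≠ 0 := right_ne_zero_of_mul hfl
      have h1 := hmax l (Finset.mem_filter.2 ⟨Finset.mem_univ _, hcl⟩) hll
      have h2 := (hp l).2 l₀.1 (mem_support_iff.2 hpl) fun h => hll (Subtype.ext h.symm)
      have h3 := D.val_mul _ _ hcl hpl
      have h4 := D.val_mul _ _ hcl (hlc l)
      simp only [r, key] at h1
      have h5 : -D.val ((p l).coeff l₀.1) + wdeg D.om l₀.1 < -D.val (lc l) + wdeg D.om l.1 ∨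
          (-D.val ((p l).coeff l₀.1) + wdeg D.om l₀.1 = -D.val (lc l) + wdeg D.om l.1 ∧
            D.prec.lt (xiPart l₀.1) (xiPart l.1)) := by
        rcases h2 with h | ⟨-, h | ⟨-, h⟩⟩
        · exact absurd (hlev l₀ l).1 h.ne
        · exact absurd (hlev l₀ l).2 h.ne
        · exact h
      rcases h1 with h1 | ⟨h1, h1'⟩ <;> rcases h5 with h5 | ⟨h5, h5'⟩
      · linarith
      · linarith
      · linarith
      · exact absurd (hplt h1' h5') (@lt_irrefl _ D.prec.toPreorder _))
    (by
      rw [hsum]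
      exact neg_ne_zero.2 hlead)
  rw [hsum, D.val_neg hlead] at hlt
  exact lt_irrefl _ hlt

end Valuation

namespace Setting

variable {n N : ℕ} {K R : Type*} [Field K] [Ring R] [Algebra K R]
  (S : Setting n N K R)

theorem ltSign_trans {a b c : MMon n N} (hab : S.ltSign a b) (hbc : S.ltSign b c) :
    S.ltSign a c := by
  have hplt {u v t} : S.D.prec.lt u v → S.D.prec.lt v t → S.D.prec.lt u t :=
    @lt_trans _ S.D.prec.toPreorder u v t
  have hp := @hplt (xiPart a.1) (xiPart b.1) (xiPart c.1)
  unfold ltSign at *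
  clear hplt
  generalize S.D.prec.lt (xiPart a.1) (xiPart b.1) = p at *
  generalize S.D.prec.lt (xiPart b.1) (xiPart c.1) = q at *
  generalize S.D.prec.lt (xiPart a.1) (xiPart c.1) = r at *
  grind

theorem ltSign_trichotomous {a b : MMon n N} (hab : a ≠ b) : S.ltSign a b ∨ S.ltSign b a := by
  have hx : a.2 = b.2 → mdeg a.1 = mdeg b.1 → S.D.prec.lt (xiPart a.1) (xiPart b.1) ∨
      S.D.prec.lt (xiPart b.1) (xiPart a.1) := fun h2 hd =>
    @lt_or_gt_of_ne _ S.D.prec _ _ fun hx =>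
      hab (Prod.ext (eq_of_mdeg_eq_of_xiPart_eq hd hx) h2)
  unfold ltSign
  grind

theorem exists_isLMsign {g : Fin N → R} (hg : g ≠ 0) : ∃ m, S.IsLMsign g m := by
  obtain ⟨i, hi⟩ := Function.ne_iff.1 hg
  have hne : (S.Psi (g i)).support.Nonempty := by simpa using hi
  obtain ⟨t, ht⟩ := hne
  have hfin : {m : MMon n N | m.1 ∈ (S.Psi (g m.2)).support}.Finite :=
    ((Set.finite_iUnion fun i => (S.Psi (g i)).support.finite_toSet).prod
      Set.finite_univ).subset fun m hm => ⟨Set.mem_iUnion.2 ⟨m.2, hm⟩, Set.mem_univ _⟩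
  obtain ⟨m, hm, hmax⟩ := Finset.exists_forall_rel_of_trichotomous (r := S.ltSign)
    (fun _ _ _ => S.ltSign_trans) (fun _ _ => S.ltSign_trichotomous)
    hfin.toFinset ⟨(t, i), hfin.mem_toFinset.2 ht⟩
  exact ⟨m, hfin.mem_toFinset.1 hm, fun m' hm' hne => hmax m' (hfin.mem_toFinset.2 hm') hne⟩

theorem exists_isSig {f : R} (hf : f ∈ S.idl) (hf0 : f ≠ 0) : ∃ m, S.IsSig f m := by
  classical
  obtain ⟨g, hg⟩ := (Submodule.mem_span_range_iff_exists_fun R).1 hf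
  have hg : S.nu g = f := hg
  let A : Set (MMon n N) := {m | ∃ g, S.nu g = f ∧ S.IsLMsign g m}
  have hA : A.Nonempty := by
    obtain ⟨m, hm⟩ := S.exists_isLMsign (g := g) fun h => hf0 (by simp [← hg, h, nu])
    exact ⟨m, g, hg, hm⟩
  let key : MMon n N → Fin N ×ₗ ℕ := fun m => toLex (m.2, mdeg m.1)
  obtain ⟨m₀, hm₀, hmin⟩ := WellFounded.has_min (InvImage.wf key wellFounded_lt) A hA
  have hfin : {m ∈ A | m.2 = m₀.2 ∧ mdeg m.1 = mdeg m₀.1}.Finite :=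
    ((finite_setOf_mdeg_eq (mdeg m₀.1)).prod (Set.finite_singleton m₀.2)).subset
      fun m hm => ⟨hm.2.2, hm.2.1⟩
  obtain ⟨m, hm, hmin'⟩ := Finset.exists_forall_rel_of_trichotomous
    (r := fun a b => S.ltSign b a)
    (fun _ _ _ h h' => S.ltSign_trans h' h) (fun _ _ h => (S.ltSign_trichotomous h).symm)
    hfin.toFinset ⟨m₀, by simpa using hm₀⟩
  have hirr : ∀ a, ¬S.ltSign a a := fun a => by
    have := @lt_irrefl _ S.D.prec.toPreorder (xiPart a.1)
    unfold ltSign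
    grind
  obtain ⟨hmA, hm2, hmd⟩ := hfin.mem_toFinset.1 hm
  refine ⟨m, hmA, fun g' m' hg' hm' hlt => ?_⟩
  have hnot := hmin m' ⟨g', hg', hm'⟩
  simp only [InvImage, key, Prod.Lex.toLex_lt_toLex] at hnot
  have hlev : m'.2 = m₀.2 ∧ mdeg m'.1 = mdeg m₀.1 := by
    unfold ltSign at hlt
    grind
  have hmm : m' ≠ m := fun h => hirr m (h ▸ hlt)
  exact hirr m (S.ltSign_trans (hmin' m' (hfin.mem_toFinset.2 ⟨⟨g', hg', hm'⟩, hlev⟩) hmm) hlt)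

theorem isSig_sig [NeZero N] {f : R} (hf : f ∈ S.idl) (hf0 : f ≠ 0) : S.IsSig f (S.sig f) := by
  have h := S.exists_isSig hf hf0
  rw [sig, dif_pos h]
  exact h.choose_spec

theorem exists_isSyzLM_le_of_inLSyz {m : MMon n N} (hm : S.inLSyz m) :
    ∃ m', S.IsSyzLM m' ∧ m'.2 = m.2 ∧ m'.1 ≤ m.1 := by
  classical
  have key : ∀ v ∈ S.LSyz, ∀ i t, (v i).coeff t ≠ 0 →
      ∃ m', S.IsSyzLM m' ∧ m'.2 = i ∧ m'.1 ≤ t := by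
    intro v hv
    induction hv using Submodule.span_induction with
    | mem v hv =>
      obtain ⟨m', hm', rfl⟩ := hv
      intro i t hne
      by_cases hi : m'.2 = i
      · subst hi
        by_cases ht : m'.1 = t
        · exact ⟨m', hm', rfl, ht.le⟩
        · simp [msingle, coeff_monomial, ht] at hne
      · simp [msingle, Pi.single_eq_of_ne' hi] at hne
    | zero => simp
    | add u v _ _ hu hv =>
      intro i t hne
      by_cases h : (u i).coeff t = 0
      · exact hv i t (by simpa [h] using hne)
      · exact hu i t h
    | smul p v _ hv =>
      intro i t hne
      rw [Pi.smul_apply, smul_eq_mul, coeff_mul] at hne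
      obtain ⟨x, hx, hne⟩ := Finset.exists_ne_zero_of_sum_ne_zero hne
      obtain ⟨m', h1, h2, h3⟩ := hv i x.2 (right_ne_zero_of_mul hne)
      refine ⟨m', h1, h2, h3.trans ?_⟩
      rw [← Finset.HasAntidiagonal.mem_antidiagonal.1 hx]
      exact le_add_self
  exact key _ hm m.2 m.1 (by simp [msingle])

/-- Every module monomial in `LSyz(F)` is itself the leading monomial of a syzygy. -/
theorem isSyzLM_of_inLSyz {m : MMon n N} (hm : S.inLSyz m) : S.IsSyzLM m := by
  obtain ⟨⟨d, i⟩, ⟨a, ha, -, hj, hLM⟩, h2, h1⟩ := S.exists_isSyzLM_le_of_inLSyz hm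
  obtain ⟨d', i'⟩ := m
  obtain rfl : i = i' := h2
  have hLM' := S.isLM_monR_mul (d' - d) hLM
  rw [tsub_add_cancel_of_le h1] at hLM'
  refine ⟨fun j => S.monR (d' - d) * a j, ?_, fun h => ?_, fun j hij => ?_, hLM'⟩
  · simp only [nu, mul_assoc, ← Finset.mul_sum] at ha ⊢
    rw [ha, mul_zero]
  · simp only at h
    simpa [h] using hLM'.1
  · simp [hj j hij]

theorem not_inLSyz_of_isSig {f : R} {m : MMon n N} (hf0 : f ≠ 0) (h : S.IsSig f m) :
    ¬S.inLSyz m := by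
  classical
  intro hm
  obtain ⟨⟨g, hg, hgm⟩, hmin⟩ := h
  have hfin : {t : Mon n | mdeg t = mdeg m.1 ∧ wdeg S.D.w t = wdeg S.D.w m.1 ∧
      S.inLSyz (t, m.2)}.Finite := (finite_setOf_mdeg_eq (mdeg m.1)).subset fun t ht => ht.1
  set L := hfin.toFinset
  have hL {t} : t ∈ L ↔ _ := hfin.mem_toFinset
  have hsyz : ∀ l : L, S.IsSyzLM (l.1, m.2) := fun l => S.isSyzLM_of_inLSyz (hL.1 l.2).2.2
  choose a ha0 _ haj haLM using hsyz
  obtain ⟨c, hc⟩ := exists_coeff_sum_eq S.D (fun l : L => S.Psi (a l m.2))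
    (fun l l' => ⟨(hL.1 l.2).1.trans (hL.1 l'.2).1.symm,
      (hL.1 l.2).2.1.trans (hL.1 l'.2).2.1.symm⟩) haLM
    fun l => (S.Psi (g m.2)).coeff l.1
  let g' : Fin N → R := fun j => g j - ∑ l, c l • a l j
  have hnu : S.nu g' = f := by
    have h0 : ∑ j, (∑ l, c l • a l j) * S.F j = 0 := by
      simp only [Finset.sum_mul]
      rw [Finset.sum_comm]
      refine Finset.sum_eq_zero fun l _ => ?_
      have := ha0 l
      simp only [nu] at this
      simp only [smul_mul_assoc, ← Finset.smul_sum, this, smul_zero]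
    simp only [nu, g', sub_mul, Finset.sum_sub_distrib] at hg ⊢
    rw [hg, h0, sub_zero]
  obtain ⟨m', hm'⟩ := S.exists_isLMsign (g := g') fun h => hf0 (by simp [← hnu, h, nu])
  refine hmin g' m' hnu hm' ?_
  obtain ⟨t, j⟩ := m'
  have ht : (S.Psi (g' j)).coeff t ≠ 0 := mem_support_iff.1 hm'.1
  have hco : (S.Psi (g' j)).coeff t =
      (S.Psi (g j)).coeff t - ∑ l, c l * (S.Psi (a l j)).coeff t := by
    simp [g', coeff_sum]
  rcases lt_trichotomy j m.2 with hj | rfl | hj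
  · exact Or.inl hj
  · have hlev : mdeg t < mdeg m.1 ∨ (mdeg t = mdeg m.1 ∧ wdeg S.D.w t ≤ wdeg S.D.w m.1) := by
      by_cases hgt : (S.Psi (g m.2)).coeff t = 0
      · rw [hco, hgt, zero_sub, neg_ne_zero] at ht
        obtain ⟨l, -, hl⟩ := Finset.exists_ne_zero_of_sum_ne_zero ht
        have := (haLM l).level_le (mem_support_iff.2 (right_ne_zero_of_mul hl))
        rwa [(hL.1 l.2).1, (hL.1 l.2).2.1] at this
      · by_cases htm : (t, m.2) = m
        · rw [← htm]
          simp
        · have := hgm.2 (t, m.2) (mem_support_iff.2 hgt) htm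
          unfold ltSign at this
          grind
    rcases hlev with h | ⟨h, h'⟩
    · exact Or.inr ⟨rfl, Or.inl h⟩
    · rcases h'.lt_or_eq with h' | h'
      · exact Or.inr ⟨rfl, Or.inr ⟨h, Or.inl h'⟩⟩
      · refine Or.inr ⟨rfl, Or.inr ⟨h, Or.inr ⟨h', Or.inl ⟨fun hin => ht ?_, hm⟩⟩⟩⟩
        rw [hco, hc ⟨t, hL.2 ⟨h, h', hin⟩⟩, sub_self]
  · refine absurd ?_ ht
    have hgj : (S.Psi (g j)).coeff t = 0 := by
      by_contra hne
      have := hgm.2 (t, j) (mem_support_iff.2 hne) fun h => hj.ne (by rw [← h])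
      unfold ltSign at this
      grind
    rw [hco, hgj, Finset.sum_eq_zero, sub_zero]
    intro l _
    rw [haj l j hj]
    simp

end Setting

end TropF5

open TropF5 MvPolynomial

variable {n N : ℕ} [NeZero N] {K R : Type*} [Field K] [Ring R] [Algebra K R]

/-- For `f ∈ I \ {0}`, the signature `s(f)` lies in `NS(Syz(F))`. -/
theorem stmt5 (S : Setting n N K R) (f : R) (hf : f ∈ S.idl) (hf0 : f ≠ 0) :
    ¬ S.inLSyz (S.sig f) := by
  exact S.not_inLSyz_of_isSig hf0 (S.isSig_sig hf hf0)

end
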